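/- arXiv:math/9810120 — 2 statements merged into one kernel-verified Lean document; each statement's English description precedes it below -/
import Mathlib

section
/- Let k be a commutative ring, let q be a polynomial in k[x₀, x₁, x₂, x₃] which is homogeneous of degree 2, and let a = (a₀, a₁, a₂, a₃) ∈ k⁴. Let D denote the differential operator a₀∂₀ + a₁∂₁ + a₂∂₂ + a₃∂₃. Then D(D(q)) is the constant polynomial 2·q(a₀, a₁, a₂, a₃). -/
open MvPolynomial

/-- The differential operator `D = a₀∂₀ + a₁∂₁ + a₂∂₂ + a₃∂₃` on
polynomials in four variables. -/
noncomputable def diffOp {k : Type*} [CommRing k] (a : Fin 4 → k)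
    (p : MvPolynomial (Fin 4) k) : MvPolynomial (Fin 4) k :=
  ∑ i : Fin 4, C (a i) * pderiv i p

theorem eval_diffOp_aux {k : Type*} [CommRing k] (q : MvPolynomial (Fin 4) k) (n : ℕ)
    (hq : q.IsHomogeneous n) (a : Fin 4 → k) :
    eval a (diffOp a q) = n * eval a q := by
  have h := congrArg (eval a) hq.sum_X_mul_pderiv
  simpa [diffOp] using h

theorem homog_diffOp_aux {k : Type*} [CommRing k] (q : MvPolynomial (Fin 4) k) (n : ℕ)
    (hq : q.IsHomogeneous n) (a : Fin 4 → k) :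
    (diffOp a q).IsHomogeneous (n - 1) := by
  refine IsHomogeneous.sum _ _ _ fun i _ => ?_
  exact (hq.pderiv (i := i)).C_mul (a i)

theorem stmt4 {k : Type*} [CommRing k] (q : MvPolynomial (Fin 4) k)
    (hq : q.IsHomogeneous 2) (a : Fin 4 → k) :
    diffOp a (diffOp a q) = C (2 * eval a q) := by
  have h1 := homog_diffOp_aux q 2 hq a
  have h2 := homog_diffOp_aux _ _ h1 a
  have h0 : (diffOp a (diffOp a q)).totalDegree = 0 := by
    have := h2.totalDegree_le
    omega
  have e := eval_diffOp_aux _ _ h1 a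
  rw [eval_diffOp_aux q 2 hq a] at e
  rw [totalDegree_eq_zero_iff_eq_C] at h0
  rw [h0] at e ⊢
  rw [eval_C] at e
  rw [e]
  simp
end

section
/- Let ρ = e^{2πi/6} and let σ, τ, ι act on ℂ[x₀, …, x₅] (indices mod 6) by σ: xᵢ ↦ xᵢ₊₁, τ: xᵢ ↦ ρ^i xᵢ, ι: xᵢ ↦ x₋ᵢ. Then each of the following four 2-dimensional subspaces of cubic forms is mapped onto itself by each of σ, τ, and ι: (1) ⟨x₀³+x₂³+x₄³, x₁³+x₃³+x₅³⟩; (2) ⟨x₀x₂x₄, x₁x₃x₅⟩; (3) ⟨x₃²x₀+x₅²x₂+x₁²x₄, x₄²x₁+x₀²x₃+x₂²x₅⟩; (4) ⟨x₁x₂x₃+x₃x₄x₅+x₅x₀x₁, x₂x₃x₄+x₄x₅x₀+x₀x₁x₂⟩. -/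
open MvPolynomial

/-- `ρ = e^{2πi/6}`. -/
noncomputable def rho6 : ℂ := Complex.exp (2 * Real.pi * Complex.I / 6)

/-- `σ : xᵢ ↦ xᵢ₊₁` on `ℂ[x₀,…,x₅]` (indices mod 6). -/
noncomputable def sigmaP : MvPolynomial (ZMod 6) ℂ →ₐ[ℂ] MvPolynomial (ZMod 6) ℂ :=
  MvPolynomial.rename (fun i => i + 1)

/-- `τ : xᵢ ↦ ρ^i xᵢ` on `ℂ[x₀,…,x₅]`. -/
noncomputable def tauP : MvPolynomial (ZMod 6) ℂ →ₐ[ℂ] MvPolynomial (ZMod 6) ℂ :=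
  MvPolynomial.aeval (fun i : ZMod 6 => C (rho6 ^ i.val) * X i)

/-- `ι : xᵢ ↦ x₋ᵢ` on `ℂ[x₀,…,x₅]`. -/
noncomputable def iotaP : MvPolynomial (ZMod 6) ℂ →ₐ[ℂ] MvPolynomial (ZMod 6) ℂ :=
  MvPolynomial.rename (fun i => -i)

/-- The four 2-dimensional spaces of cubics of Lemma 7.6. -/
noncomputable def pencil1 : Submodule ℂ (MvPolynomial (ZMod 6) ℂ) :=
  Submodule.span ℂ {X 0 ^ 3 + X 2 ^ 3 + X 4 ^ 3, X 1 ^ 3 + X 3 ^ 3 + X 5 ^ 3}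

noncomputable def pencil2 : Submodule ℂ (MvPolynomial (ZMod 6) ℂ) :=
  Submodule.span ℂ {X 0 * X 2 * X 4, X 1 * X 3 * X 5}

noncomputable def pencil3 : Submodule ℂ (MvPolynomial (ZMod 6) ℂ) :=
  Submodule.span ℂ
    {X 3 ^ 2 * X 0 + X 5 ^ 2 * X 2 + X 1 ^ 2 * X 4,
     X 4 ^ 2 * X 1 + X 0 ^ 2 * X 3 + X 2 ^ 2 * X 5}

noncomputable def pencil4 : Submodule ℂ (MvPolynomial (ZMod 6) ℂ) :=
  Submodule.span ℂ
    {X 1 * X 2 * X 3 + X 3 * X 4 * X 5 + X 5 * X 0 * X 1,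
     X 2 * X 3 * X 4 + X 4 * X 5 * X 0 + X 0 * X 1 * X 2}

theorem rho6_cube : rho6 ^ 3 = -1 := by
  unfold rho6
  rw [← Complex.exp_nat_mul, ← Complex.exp_pi_mul_I]
  congr 1
  push_cast
  ring

theorem map_pencil_swap (f : MvPolynomial (ZMod 6) ℂ →ₐ[ℂ] MvPolynomial (ZMod 6) ℂ)
    (a b : MvPolynomial (ZMod 6) ℂ) (ha : f a = b) (hb : f b = a) :
    Submodule.map f.toLinearMap (Submodule.span ℂ {a, b}) = Submodule.span ℂ {a, b} := by
  rw [Submodule.map_span, Set.image_pair, AlgHom.toLinearMap_apply, AlgHom.toLinearMap_apply,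
    ha, hb, Set.pair_comm]

theorem map_pencil_fix (f : MvPolynomial (ZMod 6) ℂ →ₐ[ℂ] MvPolynomial (ZMod 6) ℂ)
    (a b : MvPolynomial (ZMod 6) ℂ) (ha : f a = a) (hb : f b = b) :
    Submodule.map f.toLinearMap (Submodule.span ℂ {a, b}) = Submodule.span ℂ {a, b} := by
  rw [Submodule.map_span, Set.image_pair, AlgHom.toLinearMap_apply, AlgHom.toLinearMap_apply,
    ha, hb]

theorem map_pencil_neg (f : MvPolynomial (ZMod 6) ℂ →ₐ[ℂ] MvPolynomial (ZMod 6) ℂ)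
    (a b : MvPolynomial (ZMod 6) ℂ) (ha : f a = a) (hb : f b = -b) :
    Submodule.map f.toLinearMap (Submodule.span ℂ {a, b}) = Submodule.span ℂ {a, b} := by
  rw [Submodule.map_span, Set.image_pair, AlgHom.toLinearMap_apply, AlgHom.toLinearMap_apply,
    ha, hb, Submodule.span_insert, Submodule.span_insert, ← Set.neg_singleton, Submodule.span_neg]

theorem sigmaP_X (i j : ZMod 6) (h : i + 1 = j) : sigmaP (X i) = X j := by
  simp [sigmaP, h]

theorem iotaP_X (i j : ZMod 6) (h : -i = j) : iotaP (X i) = X j := by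
  simp [iotaP, h]

theorem tauP_X (i : ZMod 6) (n : ℕ) (h : i.val = n) : tauP (X i) = C rho6 ^ n * X i := by
  simp [tauP, h]

theorem C_rho6_cube : (C rho6 : MvPolynomial (ZMod 6) ℂ) ^ 3 = -1 := by
  rw [← C_pow, rho6_cube]; simp

theorem stmt8 :
    (Submodule.map sigmaP.toLinearMap pencil1 = pencil1 ∧
      Submodule.map tauP.toLinearMap pencil1 = pencil1 ∧
      Submodule.map iotaP.toLinearMap pencil1 = pencil1) ∧
    (Submodule.map sigmaP.toLinearMap pencil2 = pencil2 ∧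
      Submodule.map tauP.toLinearMap pencil2 = pencil2 ∧
      Submodule.map iotaP.toLinearMap pencil2 = pencil2) ∧
    (Submodule.map sigmaP.toLinearMap pencil3 = pencil3 ∧
      Submodule.map tauP.toLinearMap pencil3 = pencil3 ∧
      Submodule.map iotaP.toLinearMap pencil3 = pencil3) ∧
    (Submodule.map sigmaP.toLinearMap pencil4 = pencil4 ∧
      Submodule.map tauP.toLinearMap pencil4 = pencil4 ∧
      Submodule.map iotaP.toLinearMap pencil4 = pencil4) := by
  have s0 := sigmaP_X 0 1 (by decide)
  have s1 := sigmaP_X 1 2 (by decide)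
  have s2 := sigmaP_X 2 3 (by decide)
  have s3 := sigmaP_X 3 4 (by decide)
  have s4 := sigmaP_X 4 5 (by decide)
  have s5 := sigmaP_X 5 0 (by decide)
  have i0 := iotaP_X 0 0 (by decide)
  have i1 := iotaP_X 1 5 (by decide)
  have i2 := iotaP_X 2 4 (by decide)
  have i3 := iotaP_X 3 3 (by decide)
  have i4 := iotaP_X 4 2 (by decide)
  have i5 := iotaP_X 5 1 (by decide)
  have t0 := tauP_X 0 0 (by decide)
  have t1 := tauP_X 1 1 (by decide)
  have t2 := tauP_X 2 2 (by decide)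
  have t3 := tauP_X 3 3 (by decide)
  have t4 := tauP_X 4 4 (by decide)
  have t5 := tauP_X 5 5 (by decide)
  have hr := C_rho6_cube
  generalize (C rho6 : MvPolynomial (ZMod 6) ℂ) = r at *
  refine ⟨⟨map_pencil_swap _ _ _ ?_ ?_, map_pencil_neg _ _ _ ?_ ?_, map_pencil_fix _ _ _ ?_ ?_⟩,
    ⟨map_pencil_swap _ _ _ ?_ ?_, map_pencil_neg _ _ _ ?_ ?_, map_pencil_fix _ _ _ ?_ ?_⟩,
    ⟨map_pencil_swap _ _ _ ?_ ?_, map_pencil_neg _ _ _ ?_ ?_, map_pencil_fix _ _ _ ?_ ?_⟩,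
    ⟨map_pencil_swap _ _ _ ?_ ?_, map_pencil_neg _ _ _ ?_ ?_, map_pencil_fix _ _ _ ?_ ?_⟩⟩ <;>
  simp only [map_add, map_mul, map_pow, s0, s1, s2, s3, s4, s5, i0, i1, i2, i3, i4, i5,
    t0, t1, t2, t3, t4, t5] <;>
  clear s0 s1 s2 s3 s4 s5 i0 i1 i2 i3 i4 i5 t0 t1 t2 t3 t4 t5 <;>
  first
  | ring1
  | (have h6 : r ^ 6 = 1 := by linear_combination (r ^ 3 - 1) * hr
     have h9 : r ^ 9 = -1 := by linear_combination (r ^ 6 - r ^ 3 + 1) * hr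
     have h12 : r ^ 12 = 1 := by linear_combination (r ^ 6 + 1) * h6
     have h15 : r ^ 15 = -1 := by linear_combination r ^ 9 * h6 + h9
     ring_nf
     simp only [hr, h6, h9, h12, h15]
     ring)
end
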